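/- Let A and B be simple unital complex C*-algebras with A oddly decomposable, φ : GL(A) → GL(B) a group isomorphism, and θ the induced map on idempotents. Then for every e ∈ Ĩ(A) and every f ∈ Ĩ(A), either c_f = c_e or c_f = c_e⁻¹ (as functions on ℂ∖{0}); that is, Ĩ(A) = I_{c_e} ∪ I_{c̄_e}. -/

import Mathlib

noncomputable section

/-- The symmetry `1 - 2e` associated to an idempotent `e` is a unit (its own inverse). -/
def symUnit {A : Type*} [Ring A] {e : A} (he : IsIdempotentElem e) : Aˣ where
  val := 1 - 2 * e
  inv := 1 - 2 * e
  val_inv := by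
    have h : e * e = e := he
    have expand : (1 - 2 * e) * (1 - 2 * e) = 1 - 4 * e + 4 * (e * e) := by noncomm_ring
    rw [expand, h]; noncomm_ring
  inv_val := by
    have h : e * e = e := he
    have expand : (1 - 2 * e) * (1 - 2 * e) = 1 - 4 * e + 4 * (e * e) := by noncomm_ring
    rw [expand, h]; noncomm_ring

/-- The map `θ_φ` induced on idempotents by a map `φ` between the groups of invertible
elements, determined by `1 - 2 θ_φ(e) = φ(1 - 2e)`, i.e. `θ_φ(e) = (1 - φ(1 - 2e))/2`;
it is extended by `0` off the set of idempotents. -/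
noncomputable def theta {A B : Type*} [Ring A] [Ring B] [Algebra ℂ B]
    (φ : Aˣ → Bˣ) (e : A) : B :=
  letI := Classical.propDecidable (IsIdempotentElem e)
  if h : IsIdempotentElem e then (2 : ℂ)⁻¹ • ((1 : B) - (φ (symUnit h) : B)) else 0

/-- `a` and `b` are coefficient maps for the idempotent `e` (w.r.t. `φ`):
`φ(λe + 1 - e) = a(λ) θ(e) + b(λ) θ(1-e)` for all nonzero `λ`. -/
def IsCoeffMaps {A B : Type*} [Ring A] [Ring B] [Algebra ℂ A] [Algebra ℂ B]
    (φ : Aˣ → Bˣ) (e : A) (a b : ℂˣ →* ℂˣ) : Prop :=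
  ∀ (lam : ℂˣ) (v : Aˣ), (v : A) = (lam : ℂ) • e + 1 - e →
    (φ v : B) = ((a lam : ℂˣ) : ℂ) • theta φ e + ((b lam : ℂˣ) : ℂ) • theta φ (1 - e)

/-- `c(λ) = a(λ) b(λ)⁻¹`, as an element of `ℂˣ`. -/
def cOf (a b : ℂˣ →* ℂˣ) (lam : ℂˣ) : ℂˣ := a lam * (b lam)⁻¹

/-- `e ∼_c f`: the functions `c_e` and `c_f` agree (for some, equivalently any,
choice of coefficient maps). -/
def cEquiv {A B : Type*} [Ring A] [Ring B] [Algebra ℂ A] [Algebra ℂ B]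
    (φ : Aˣ → Bˣ) (e f : A) : Prop :=
  ∃ ae be af bf : ℂˣ →* ℂˣ, IsCoeffMaps φ e ae be ∧ IsCoeffMaps φ f af bf ∧
    ∀ lam : ℂˣ, cOf ae be lam = cOf af bf lam

/-- `c_f = c_e⁻¹` (pointwise multiplicative inverse), for some choice of coefficient maps. -/
def cAntiEquiv {A B : Type*} [Ring A] [Ring B] [Algebra ℂ A] [Algebra ℂ B]
    (φ : Aˣ → Bˣ) (e f : A) : Prop :=
  ∃ ae be af bf : ℂˣ →* ℂˣ, IsCoeffMaps φ e ae be ∧ IsCoeffMaps φ f af bf ∧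
    ∀ lam : ℂˣ, cOf af bf lam = (cOf ae be lam)⁻¹

/-- A unital ring is oddly decomposable if for every pair of nontrivial idempotents
`e, f` there is an odd integer `n ≥ 3` and `n` pairwise orthogonal nontrivial
idempotents `g₁, …, gₙ` summing to `f`, such that each `gᵢ` is similar to some
nontrivial idempotent `gᵢ'` with `gᵢ' e = e gᵢ' = gᵢ' ≠ e`. -/
def OddlyDecomposable (A : Type*) [Ring A] : Prop :=
  ∀ e f : A, IsIdempotentElem e → e ≠ 0 → e ≠ 1 → IsIdempotentElem f → f ≠ 0 → f ≠ 1 →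
    ∃ n : ℕ, Odd n ∧ 3 ≤ n ∧ ∃ g : Fin n → A,
      (∀ i, IsIdempotentElem (g i) ∧ g i ≠ 0 ∧ g i ≠ 1) ∧
      (∀ i j, i ≠ j → g i * g j = 0) ∧
      (∑ i, g i) = f ∧
      ∀ i, ∃ (g' : A) (u : Aˣ), IsIdempotentElem g' ∧ g' ≠ 0 ∧ g' ≠ 1 ∧
        g' = (u : A) * g i * ((u⁻¹ : Aˣ) : A) ∧ g' * e = g' ∧ e * g' = g' ∧ g' ≠ e

section Center

variable {R : Type*} [NormedRing R] [NormedAlgebra ℂ R] [CompleteSpace R]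

/-- In a complex Banach algebra every element is a translate of a unit by a scalar. -/
lemma exists_unit_eq_add_algebraMap (x : R) :
    ∃ (t : ℂ) (u : Rˣ), (u : R) = x + algebraMap ℂ R t := by
  have hne : (resolventSet ℂ x).Nonempty := by
    by_contra h
    rw [Set.not_nonempty_iff_eq_empty] at h
    have hb := (spectrum.isCompact (𝕜 := ℂ) x).isBounded
    rw [spectrum, h, Set.compl_empty] at hb
    exact NormedSpace.unbounded_univ ℂ ℂ hb
  obtain ⟨t, ht⟩ := hne
  obtain ⟨u, hu⟩ := (spectrum.mem_resolventSet_iff.mp ht).neg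
  exact ⟨-t, u, by rw [hu, map_neg]; abel⟩

/-- Some scalar translate of an element of the corner `p R p` has no inverse in the corner. -/
lemma exists_corner_sub_smul_not_invertible {p z : R} (hp : IsIdempotentElem p) (hp0 : p ≠ 0)
    (hpz : p * z = z) :
    ∃ t : ℂ, ∀ y : R, p * y = y → (z - t • p) * y = p → y * (z - t • p) = p → False := by
  let E : Submodule ℂ R := LinearMap.ker (LinearMap.mulLeft ℂ (1 - p))
  have hE : ∀ x, x ∈ E ↔ p * x = x := fun x => by
    simp only [E, LinearMap.mem_ker, LinearMap.mulLeft_apply, sub_mul, one_mul, sub_eq_zero]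
    exact eq_comm
  have hclosed : IsClosed (E : Set R) := by
    have : (E : Set R) = {x | p * x = x} := Set.ext hE
    rw [this]
    exact isClosed_eq (by fun_prop) continuous_id
  have : CompleteSpace E := hclosed.completeSpace_coe
  have : Nontrivial E := ⟨⟨⟨p, (hE p).mpr hp⟩, 0, fun h => hp0 (congrArg Subtype.val h)⟩⟩
  have hmem : ∀ w : R, p * w = w → ∀ x ∈ E, w * x ∈ E := fun w hw x _ => by
    rw [hE, ← mul_assoc, hw]
  let L : (w : R) → p * w = w → (E →L[ℂ] E) := fun w hw =>
    ((ContinuousLinearMap.mul ℂ R w).comp E.subtypeL).codRestrict E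
      (fun x => hmem w hw x x.2)
  have hL : ∀ w hw (x : E), ((L w hw x : E) : R) = w * x := fun w hw x => rfl
  obtain ⟨t, ht⟩ := spectrum.nonempty (A := E →L[ℂ] E) (L z hpz)
  refine ⟨t, fun y hpy h₁ h₂ => ht ?_⟩
  rw [spectrum.mem_resolventSet_iff]
  refine isUnit_iff_exists.mpr ⟨-(L y hpy), ?_, ?_⟩
  · ext x
    have hx := (hE x).mp x.2
    have : (z - t • p) * y * (x : R) = x := by rw [h₁, hx]
    simp only [Algebra.algebraMap_eq_smul_one, mul_neg, neg_apply,
      mul_apply_eq_comp, sub_apply, smul_apply,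
      one_apply_eq_self, Submodule.coe_neg, Submodule.coe_sub, Submodule.coe_smul, hL]
    rw [sub_mul, sub_mul, smul_mul_assoc, smul_mul_assoc, hpy, mul_assoc] at this
    rw [smul_neg, sub_neg_eq_add, neg_add_eq_sub, this]
  · ext x
    have hx := (hE x).mp x.2
    have : y * (z - t • p) * (x : R) = x := by rw [h₂, hx]
    simp only [Algebra.algebraMap_eq_smul_one, neg_apply,
      mul_apply_eq_comp, sub_apply, smul_apply,
      one_apply_eq_self, Submodule.coe_neg, Submodule.coe_sub, Submodule.coe_smul, hL]
    rw [mul_assoc, sub_mul, smul_mul_assoc, hx] at this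
    rw [← mul_neg, neg_sub, this]

/-- In a simple ring, a nonzero element `w` of the center of the corner `p R p` is invertible
there. -/
lemma exists_corner_inverse {R : Type*} [Ring R] [IsSimpleRing R] {p w : R}
    (hp : IsIdempotentElem p) (hpw : p * w = w) (hwp : w * p = w) (hw : w ≠ 0)
    (hcomm : ∀ x, Commute w (p * x * p)) :
    ∃ y, p * y = y ∧ w * y = p ∧ y * w = p := by
  have hpp : p * p = p := hp
  have key : ∀ x ∈ TwoSidedIdeal.span {w}, ∀ a b, ∃ y, p * y = y ∧ w * y = p * (a * x * b) * p ∧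
      y * w = p * (a * x * b) * p := by
    intro x hx
    induction hx using TwoSidedIdeal.span_induction with
    | mem x hx =>
      intro a b
      rw [Set.mem_singleton_iff] at hx
      have h : p * (a * x * b) * p = (p * a * p) * w * (p * b * p) := by
        rw [hx]
        conv_lhs => rw [← hpw, ← hwp]
        simp only [mul_assoc]
      refine ⟨(p * a * p) * (p * b * p), by simp only [← mul_assoc, hpp], ?_, ?_⟩
      · rw [h, ← mul_assoc, (hcomm a).eq]
      · rw [h, mul_assoc, mul_assoc (p * a * p), (hcomm b).eq]
    | zero => exact fun a b => ⟨0, by simp⟩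
    | add x y _ _ hx hy =>
      intro a b
      obtain ⟨c, hc₁, hc₂, hc₃⟩ := hx a b
      obtain ⟨d, hd₁, hd₂, hd₃⟩ := hy a b
      exact ⟨c + d, by rw [mul_add, hc₁, hd₁], by rw [mul_add, hc₂, hd₂]; noncomm_ring,
        by rw [add_mul, hc₃, hd₃]; noncomm_ring⟩
    | neg x _ hx =>
      intro a b
      obtain ⟨c, hc₁, hc₂, hc₃⟩ := hx a b
      exact ⟨-c, by rw [mul_neg, hc₁], by rw [mul_neg, hc₂]; noncomm_ring,
        by rw [neg_mul, hc₃]; noncomm_ring⟩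
    | left_absorb c x _ hx => exact fun a b => by simpa only [mul_assoc] using hx (a * c) b
    | right_absorb c x _ hx => exact fun a b => by simpa only [mul_assoc] using hx a (c * b)
  have h1 : (1 : R) ∈ TwoSidedIdeal.span {w} :=
    IsSimpleRing.one_mem_of_ne_zero_mem _ hw (TwoSidedIdeal.subset_span rfl)
  simpa [hpp] using key 1 h1 1 1

variable [IsSimpleRing R]

/-- The center of a corner of a simple Banach algebra consists of scalars. -/
lemma exists_eq_smul_of_mem_center_corner {p z : R} (hp : IsIdempotentElem p) (hp0 : p ≠ 0)
    (hpz : p * z = z) (hzp : z * p = z) (hcomm : ∀ x, Commute z (p * x * p)) :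
    ∃ t : ℂ, z = t • p := by
  have hpp : p * p = p := hp
  obtain ⟨t, ht⟩ := exists_corner_sub_smul_not_invertible hp hp0 hpz
  refine ⟨t, by_contra fun hne => ?_⟩
  obtain ⟨y, h₁, h₂, h₃⟩ := exists_corner_inverse (w := z - t • p) hp
    (by rw [mul_sub, hpz, mul_smul_comm, hpp]) (by rw [sub_mul, hzp, smul_mul_assoc, hpp])
    (sub_ne_zero.mpr hne) (fun x => (hcomm x).sub_left
      (Commute.smul_left (by
        simp only [Commute, SemiconjBy, ← mul_assoc, hpp]
        simp only [mul_assoc, hpp]) t))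
  exact ht y h₁ h₂ h₃

/-- An element commuting with every unit that commutes with the idempotent `p` is a linear
combination of `p` and `1 - p`. -/
lemma exists_eq_smul_add_smul {p w : R} (hp : IsIdempotentElem p) (hp0 : p ≠ 0) (hp1 : p ≠ 1)
    (hw : ∀ u : Rˣ, Commute (u : R) p → Commute w u) :
    ∃ s t : ℂ, w = s • p + t • (1 - p) := by
  have hw' : ∀ x : R, Commute x p → Commute w x := fun x hx => by
    obtain ⟨t, u, hu⟩ := exists_unit_eq_add_algebraMap x
    have h := hw u (by rw [hu]; exact hx.add_left (Algebra.commutes t p))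
    rw [hu] at h
    simpa using h.sub_right (Algebra.commutes t w).symm
  have corner : ∀ q : R, IsIdempotentElem q → q ≠ 0 → (∀ x, Commute x q → Commute w x) →
      ∃ t : ℂ, w * q = t • q := fun q hq hq0 hwq => by
    have hqq : q * q = q := hq
    have hc := (hwq q rfl).eq
    refine exists_eq_smul_of_mem_center_corner hq hq0 (by rw [← mul_assoc, ← hc, mul_assoc, hqq])
      (by rw [mul_assoc, hqq]) (fun x => Commute.mul_left (hwq _ ?_) ?_)
    all_goals
      simp only [Commute, SemiconjBy, ← mul_assoc, hqq]
      simp only [mul_assoc, hqq]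
  obtain ⟨s, hs⟩ := corner p hp hp0 hw'
  obtain ⟨t, ht⟩ := corner (1 - p) hp.one_sub (sub_ne_zero.mpr hp1.symm) fun x hx =>
    hw' x (by simpa using (Commute.one_right x).sub_right hx)
  exact ⟨s, t, by rw [← hs, ← ht]; noncomm_ring⟩

/-- A central unit of order dividing two in a simple Banach algebra is `1` or `-1`. -/
lemma eq_one_or_eq_neg_one_of_central {w : Rˣ} (hw : ∀ u : Rˣ, Commute w u) (h2 : w * w = 1) :
    w = 1 ∨ w = -1 := by
  obtain ⟨t, ht⟩ := exists_eq_smul_of_mem_center_corner (z := (w : R)) IsIdempotentElem.one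
    one_ne_zero (one_mul _) (mul_one _) fun x => by
      obtain ⟨t, u, hu⟩ := exists_unit_eq_add_algebraMap x
      have h : Commute (w : R) u := congrArg Units.val (hw u)
      rw [hu] at h
      simpa using h.sub_right (Algebra.commutes t (w : R)).symm
  have h2' : (w : R) * w = 1 := congrArg Units.val h2
  have htt : t * t = 1 := by
    rw [ht, smul_mul_smul_comm, one_mul] at h2'
    exact smul_left_injective ℂ (one_ne_zero (α := R)) (by simpa using h2')
  rcases mul_self_eq_one_iff.mp htt with rfl | rfl
  · left; ext; simpa using ht
  · right; ext; simpa using ht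

end Center

section Theta

lemma commute_symUnit_iff {R : Type*} [Ring R] [Algebra ℂ R] {e x : R} (he : IsIdempotentElem e) :
    Commute x (symUnit he : R) ↔ Commute x e := by
  change Commute x (1 - 2 * e) ↔ _
  constructor
  · intro h
    have h' : Commute x ((2 : ℂ)⁻¹ • (1 - (1 - 2 * e))) :=
      ((Commute.one_right x).sub_right h).smul_right _
    have : (2 : ℂ)⁻¹ • (1 - (1 - 2 * e)) = e := by
      rw [sub_sub_cancel, two_mul, ← two_smul ℂ e, smul_smul]; norm_num
    rwa [this] at h'
  · exact fun h => (Commute.one_right x).sub_right ((Nat.cast_commute 2 x).symm.mul_right h)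

section

variable {R S : Type*} [Ring R] [Ring S] [Algebra ℂ S] {φ : Rˣ ≃* Sˣ}

lemma theta_eq {e : R} (he : IsIdempotentElem e) :
    theta φ e = (2 : ℂ)⁻¹ • ((1 : S) - (φ (symUnit he) : S)) := by
  simp [theta, he]

lemma val_symUnit_eq {e : R} (he : IsIdempotentElem e) :
    (φ (symUnit he) : S) = 1 - 2 * theta φ e := by
  rw [theta_eq he, two_mul, ← two_smul ℂ, smul_smul]
  norm_num

lemma symUnit_mul_self {e : R} (he : IsIdempotentElem e) : symUnit he * symUnit he = 1 :=
  Units.ext (symUnit he).val_inv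

lemma isIdempotentElem_theta {e : R} (he : IsIdempotentElem e) :
    IsIdempotentElem (theta φ e) := by
  have h : (φ (symUnit he) : S) * φ (symUnit he) = 1 := by
    rw [← Units.val_mul, ← map_mul, symUnit_mul_self, map_one, Units.val_one]
  rw [IsIdempotentElem, theta_eq he, smul_mul_smul_comm, sub_mul, mul_sub, mul_sub, h, mul_one,
    one_mul, mul_one]
  have : (1 : S) - φ (symUnit he) - (φ (symUnit he) - 1) =
      (2 : ℂ) • (1 - (φ (symUnit he) : S)) := by rw [two_smul]; abel
  rw [this, smul_smul]
  norm_num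

lemma theta_ne_zero [Algebra ℂ R] {e : R} (he : IsIdempotentElem e) (he0 : e ≠ 0) :
    theta φ e ≠ 0 := fun h => by
  have h1 := val_symUnit_eq (φ := φ) he
  rw [h, mul_zero, sub_zero, ← Units.val_one, Units.val_inj, ← map_one φ, φ.injective.eq_iff] at h1
  have h2 : 1 - 2 * e = 1 := congrArg Units.val h1
  rw [sub_eq_self, two_mul, ← two_smul ℂ e, smul_eq_zero] at h2
  simp_all

/-- `θ` intertwines conjugation by `u` and conjugation by `φ u`. -/
lemma theta_conj {e : R} (he : IsIdempotentElem e) (u : Rˣ)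
    (he' : IsIdempotentElem ((u : R) * e * ((u⁻¹ : Rˣ) : R))) :
    theta φ ((u : R) * e * ((u⁻¹ : Rˣ) : R)) = (φ u : S) * theta φ e * ((φ u)⁻¹ : Sˣ) := by
  have h : symUnit he' = u * symUnit he * u⁻¹ := by
    ext
    change 1 - 2 * ((u : R) * e * ((u⁻¹ : Rˣ) : R)) = u * (1 - 2 * e) * ((u⁻¹ : Rˣ) : R)
    rw [mul_sub, sub_mul, mul_one, Units.mul_inv]
    noncomm_ring
  rw [theta_eq he', theta_eq he, h]
  simp [mul_sub, sub_mul]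

lemma commute_theta [Algebra ℂ R] {e f : R} (he : IsIdempotentElem e) (hf : IsIdempotentElem f)
    (h : Commute e f) : Commute (theta φ e) (theta φ f) := by
  have hs : Commute (symUnit he) (symUnit hf) := by
    refine Units.ext ?_
    exact ((commute_symUnit_iff hf).mpr ((commute_symUnit_iff he).mpr h.symm).symm).eq
  have hφ : Commute (φ (symUnit he) : S) (φ (symUnit hf)) := (hs.map φ).units_val
  rw [theta_eq he, theta_eq hf]
  exact (((Commute.one_left _).sub_left ((Commute.one_right _).sub_right hφ)).smul_left _).smul_right _

lemma theta_add {e f : R} (he : IsIdempotentElem e) (hf : IsIdempotentElem f)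
    (hef : e * f = 0) (hadd : IsIdempotentElem (e + f)) :
    theta φ (e + f) = theta φ e + theta φ f - 2 * (theta φ e * theta φ f) := by
  have hs : symUnit hadd = symUnit he * symUnit hf := by
    ext
    change 1 - 2 * (e + f) = (1 - 2 * e) * (1 - 2 * f)
    have : (1 - 2 * e) * (1 - 2 * f) = 1 - 2 * (e + f) + 4 * (e * f) := by noncomm_ring
    rw [this, hef]; noncomm_ring
  rw [theta_eq hadd, hs, map_mul, Units.val_mul, val_symUnit_eq, val_symUnit_eq]
  have : 1 - (1 - 2 * theta φ e) * (1 - 2 * theta φ f) =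
      (2 : ℂ) • (theta φ e + theta φ f - 2 * (theta φ e * theta φ f)) := by
    rw [two_smul]; noncomm_ring
  rw [this, smul_smul]
  norm_num

end

section

variable {R S : Type*} [Ring R] [Algebra ℂ R] [Nontrivial R] [NormedRing S] [NormedAlgebra ℂ S]
  [CompleteSpace S] [IsSimpleRing S] {φ : Rˣ ≃* Sˣ}

lemma map_neg_one_eq : φ (-1) = -1 := by
  refine (eq_one_or_eq_neg_one_of_central (w := φ (-1)) (fun u => ?_) ?_).resolve_left fun h => ?_
  · obtain ⟨v, rfl⟩ := φ.surjective u
    exact (Commute.neg_one_left v).map φ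
  · rw [← map_mul]; simp
  · rw [← map_one φ, φ.injective.eq_iff] at h
    have h' : (-1 : R) = 1 := congrArg Units.val h
    have h2 : (2 : ℂ) • (1 : R) = 0 := by
      rw [two_smul]; nth_rw 1 [← h']; simp
    simp at h2

lemma theta_one_sub {e : R} (he : IsIdempotentElem e) : theta φ (1 - e) = 1 - theta φ e := by
  have hs : symUnit he.one_sub = -1 * symUnit he := by
    ext
    change 1 - 2 * (1 - e) = -1 * (1 - 2 * e)
    noncomm_ring
  rw [theta_eq he.one_sub, hs, map_mul, map_neg_one_eq, Units.val_mul, val_symUnit_eq]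
  have : (1 : S) - ((-1 : Sˣ) : S) * (1 - 2 * theta φ e) = (2 : ℂ) • (1 - theta φ e) := by
    rw [two_smul, Units.val_neg, Units.val_one]; noncomm_ring
  rw [this, smul_smul]
  norm_num

lemma theta_ne_one {e : R} (he : IsIdempotentElem e) (he1 : e ≠ 1) : theta φ e ≠ 1 := fun h =>
  theta_ne_zero (φ := φ) he.one_sub (sub_ne_zero.mpr he1.symm) (by rw [theta_one_sub he, h, sub_self])

end

end Theta

section CoeffMaps

/-- The unit `λ e + (1 - e)`. -/
def scaleUnit {R : Type*} [Ring R] [Algebra ℂ R] {e : R} (he : IsIdempotentElem e) :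
    ℂˣ →* Rˣ :=
  MonoidHom.toHomUnits
    { toFun := fun lam => (lam : ℂ) • e + 1 - e
      map_one' := by simp
      map_mul' := fun x y => by
        have h : e * e = e := he
        simp only [Units.val_mul, sub_mul, mul_sub, add_mul, mul_add, smul_mul_assoc,
          mul_smul_comm, h, one_mul, mul_one, mul_smul]
        rw [smul_comm (x : ℂ)]
        module }

lemma val_scaleUnit {R : Type*} [Ring R] [Algebra ℂ R] {e : R} (he : IsIdempotentElem e)
    (lam : ℂˣ) : (scaleUnit he lam : R) = (lam : ℂ) • e + 1 - e := rfl

lemma smul_add_smul_mul {S : Type*} [Ring S] [Algebra ℂ S] {p : S} (hp : IsIdempotentElem p)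
    (a b c d : ℂ) : (a • p + b • (1 - p)) * (c • p + d • (1 - p)) =
      (a * c) • p + (b * d) • (1 - p) := by
  have h : p * p = p := hp
  simp only [mul_add, add_mul, smul_mul_smul_comm, mul_sub, sub_mul, h, mul_one, one_mul, sub_self,
    smul_zero, add_zero, sub_zero, zero_add]

lemma smul_add_smul_inj {S : Type*} [Ring S] [Algebra ℂ S] {p : S} (hp : IsIdempotentElem p)
    (hp0 : p ≠ 0) (hp1 : p ≠ 1) {a b c d : ℂ}
    (h : a • p + b • (1 - p) = c • p + d • (1 - p)) : a = c ∧ b = d := by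
  have hpp : p * p = p := hp
  constructor
  · refine smul_left_injective ℂ hp0 ?_
    simpa [add_mul, sub_mul, hpp] using congrArg (· * p) h
  · refine smul_left_injective ℂ (sub_ne_zero.mpr hp1.symm) ?_
    simpa [add_mul, sub_mul, mul_sub, hpp] using congrArg (· * (1 - p)) h

section

variable {R S : Type*} [Ring R] [Algebra ℂ R] [Nontrivial R] [NormedRing S] [NormedAlgebra ℂ S]
  [CompleteSpace S] [IsSimpleRing S]

/-- Coefficient maps exist for every nontrivial idempotent. -/
lemma exists_isCoeffMaps (φ : Rˣ ≃* Sˣ) {e : R} (he : IsIdempotentElem e) (he0 : e ≠ 0)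
    (he1 : e ≠ 1) : ∃ a b, IsCoeffMaps φ e a b := by
  have hp := isIdempotentElem_theta (φ := φ) he
  have hp0 := theta_ne_zero (φ := φ) he he0
  have hp1 := theta_ne_one (φ := φ) he he1
  have key : ∀ lam : ℂˣ, ∃ s t : ℂ,
      (φ (scaleUnit he lam) : S) = s • theta φ e + t • (1 - theta φ e) := fun lam => by
    refine exists_eq_smul_add_smul hp hp0 hp1 fun u hu => ?_
    obtain ⟨v, rfl⟩ := φ.surjective u
    have h₁ : Commute (φ v : S) (φ (symUnit he) : S) := by
      rw [val_symUnit_eq]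
      exact (Commute.one_right _).sub_right ((Nat.cast_commute 2 _).symm.mul_right hu)
    have h₂ : Commute v (symUnit he) :=
      φ.injective (by rw [map_mul, map_mul]; exact Units.ext h₁)
    have h₃ : Commute (v : R) e := (commute_symUnit_iff he).mp h₂.units_val
    have h₄ : Commute (scaleUnit he lam) v := by
      refine Units.ext ?_
      exact (((h₃.smul_right (lam : ℂ)).add_right (Commute.one_right _)).sub_right h₃).symm.eq
    exact (h₄.map φ).units_val
  choose s t hst using key
  have h1 := hst 1
  rw [map_one, map_one, Units.val_one] at h1
  have h1' := smul_add_smul_inj hp hp0 hp1 (a := 1) (b := 1) (by rw [← h1]; simp)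
  have hmul : ∀ x y, s (x * y) = s x * s y ∧ t (x * y) = t x * t y := fun x y =>
    smul_add_smul_inj hp hp0 hp1 (by
      rw [← hst, map_mul, map_mul, Units.val_mul, hst, hst, smul_add_smul_mul hp])
  refine ⟨MonoidHom.toHomUnits ⟨⟨s, h1'.1.symm⟩, fun x y => (hmul x y).1⟩,
    MonoidHom.toHomUnits ⟨⟨t, h1'.2.symm⟩, fun x y => (hmul x y).2⟩, fun lam v hv => ?_⟩
  obtain rfl : v = scaleUnit he lam := Units.ext hv
  rw [hst, theta_one_sub he]
  rfl

/-- Similar idempotents have the same coefficient maps. -/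
lemma IsCoeffMaps.conj {φ : Rˣ ≃* Sˣ} {e : R} {a b : ℂˣ →* ℂˣ} (h : IsCoeffMaps φ e a b)
    (he : IsIdempotentElem e) (u : Rˣ)
    (he' : IsIdempotentElem ((u : R) * e * ((u⁻¹ : Rˣ) : R))) :
    IsCoeffMaps φ ((u : R) * e * ((u⁻¹ : Rˣ) : R)) a b := fun lam v hv => by
  have hv' : v = u * scaleUnit he lam * u⁻¹ := by
    ext
    simp [hv, val_scaleUnit, mul_add, mul_sub, add_mul, sub_mul]
  have hl := h lam _ (val_scaleUnit he lam)
  rw [theta_one_sub he] at hl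
  rw [theta_one_sub he', theta_conj he u he', hv', map_mul, map_mul, map_inv, Units.val_mul,
    Units.val_mul, hl]
  simp [mul_add, mul_sub, add_mul, sub_mul]

/-- If `g` is a proper subidempotent of `f`, then `c_f` is `c_g` or its inverse. -/
lemma cOf_eq_or_eq_inv_of_mul_eq {φ : Rˣ ≃* Sˣ} {g f : R} (hg : IsIdempotentElem g)
    (hf : IsIdempotentElem f) (hg0 : g ≠ 0) (hgf : g ≠ f) (hf1 : f ≠ 1)
    (h₁ : g * f = g) (h₂ : f * g = g) {a b a' b' : ℂˣ →* ℂˣ} (hab : IsCoeffMaps φ g a b)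
    (hab' : IsCoeffMaps φ f a' b') :
    (∀ lam, cOf a' b' lam = cOf a b lam) ∨ (∀ lam, cOf a' b' lam = (cOf a b lam)⁻¹) := by
  have hgg : g * g = g := hg
  have hff : f * f = f := hf
  have hh : IsIdempotentElem (f - g) := by
    rw [IsIdempotentElem, mul_sub, sub_mul, sub_mul, h₁, h₂, hgg, hff]; abel
  have hg1 : g ≠ 1 := fun h => hf1 (by rwa [h, one_mul] at h₁)
  have hh0 : f - g ≠ 0 := sub_ne_zero.mpr hgf.symm
  have hh1 : f - g ≠ 1 := fun h => hg0 (by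
    have := congrArg (g * ·) h
    simpa [mul_sub, h₁, hgg] using this.symm)
  have hgh : g * (f - g) = 0 := by rw [mul_sub, h₁, hgg, sub_self]
  have hhg : (f - g) * g = 0 := by rw [sub_mul, h₂, hgg, sub_self]
  obtain ⟨c, d, hcd⟩ := exists_isCoeffMaps φ hh hh0 hh1
  have hθ := theta_add (φ := φ) hg hh hgh (by rwa [add_sub_cancel])
  rw [add_sub_cancel] at hθ
  have hcomm := (commute_theta (φ := φ) hg hh (hgh.trans hhg.symm)).eq
  have hf0 : f ≠ 0 := fun h => hg0 (by rw [← h₁, h, mul_zero])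
  have hp := isIdempotentElem_theta (φ := φ) hg
  have hq := isIdempotentElem_theta (φ := φ) hh
  have hp0 := theta_ne_zero (φ := φ) hg hg0
  have hp1 := theta_ne_one (φ := φ) hg hg1
  have hq0 := theta_ne_zero (φ := φ) hh hh0
  have hq1 := theta_ne_one (φ := φ) hh hh1
  have hr0 := theta_ne_zero (φ := φ) hf hf0
  have hr1 := theta_ne_one (φ := φ) hf hf1
  have main : ∀ lam : ℂˣ, (a' lam : ℂ) • theta φ f + (b' lam : ℂ) • (1 - theta φ f) =
      ((a lam : ℂ) • theta φ g + (b lam : ℂ) • (1 - theta φ g)) *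
      ((c lam : ℂ) • theta φ (f - g) + (d lam : ℂ) • (1 - theta φ (f - g))) := fun lam => by
    have aux : ∀ h : R, g * h = 0 → (lam : ℂ) • (g + h) + 1 - (g + h) =
        ((lam : ℂ) • g + 1 - g) * ((lam : ℂ) • h + 1 - h) := fun h hgh' => by
      simp only [sub_mul, add_mul, mul_add, mul_sub, smul_mul_assoc, mul_smul_comm, hgh',
        smul_zero, smul_add, one_mul, mul_one]
      module
    have hs : scaleUnit hf lam = scaleUnit hg lam * scaleUnit hh lam := by
      ext
      rw [Units.val_mul, val_scaleUnit, val_scaleUnit, val_scaleUnit, ← aux _ hgh, add_sub_cancel]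
    have e₁ := hab lam _ (val_scaleUnit hg lam)
    have e₂ := hcd lam _ (val_scaleUnit hh lam)
    have e₃ := hab' lam _ (val_scaleUnit hf lam)
    rw [theta_one_sub hg] at e₁
    rw [theta_one_sub hh] at e₂
    rw [theta_one_sub hf] at e₃
    rw [← e₁, ← e₂, ← e₃, hs, map_mul, Units.val_mul]
  generalize theta φ g = p at *
  generalize theta φ (f - g) = q at *
  generalize theta φ f = r at *
  subst hθ
  have hpp : p * p = p := hp
  have hqq : q * q = q := hq
  have hqp : q * p = p * q := hcomm.symm
  have joint : ∀ (x : S) (k l : ℂ), x ≠ 0 → p * x = k • x → q * x = l • x → ∀ lam : ℂˣ,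
      (a' lam : ℂ) * (k + l - 2 * (k * l)) + b' lam * (1 - (k + l - 2 * (k * l))) =
        (a lam * k + b lam * (1 - k)) * (c lam * l + d lam * (1 - l)) :=
    fun x k l hx hk hl lam => by
      refine smul_left_injective ℂ hx ?_
      have h := congrArg (· * x) (main lam)
      simp only [add_mul, sub_mul, mul_assoc, smul_mul_assoc, one_mul, hl, hk, two_mul, mul_add,
        mul_sub, mul_smul_comm] at h
      simp only
      calc _ = _ := by module
        _ = _ := h
        _ = _ := by module
  have h11 : p * q ≠ 0 → ∀ lam, b' lam = a lam * c lam := fun hx lam => by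
    have := joint (p * q) 1 1 hx (by rw [← mul_assoc, hpp, one_smul])
      (by rw [← mul_assoc, hqp, mul_assoc, hqq, one_smul]) lam
    ext; push_cast; linear_combination this
  have h10 : p * (1 - q) ≠ 0 → ∀ lam, a' lam = a lam * d lam := fun hx lam => by
    have := joint (p * (1 - q)) 1 0 hx (by rw [← mul_assoc, hpp, one_smul])
      (by rw [← mul_assoc, hqp, mul_assoc, mul_sub, hqq]; simp) lam
    ext; push_cast; linear_combination this
  have h01 : (1 - p) * q ≠ 0 → ∀ lam, a' lam = b lam * c lam := fun hx lam => by
    have := joint ((1 - p) * q) 0 1 hx (by rw [← mul_assoc, mul_sub, hpp]; simp)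
      (by rw [← mul_assoc, mul_sub, hqp, mul_one, sub_mul, mul_assoc, hqq, one_smul, sub_mul,
        one_mul]) lam
    ext; push_cast; linear_combination this
  have h00 : (1 - p) * (1 - q) ≠ 0 → ∀ lam, b' lam = b lam * d lam := fun hx lam => by
    have := joint ((1 - p) * (1 - q)) 0 0 hx (by rw [← mul_assoc, mul_sub p, hpp]; simp)
      (by
        have : q * ((1 - p) * (1 - q)) = q - q * q - (q * p - (q * p) * q) := by noncomm_ring
        rw [this, hqp, mul_assoc, hqq]; simp) lam
    ext; push_cast; linear_combination this
  by_cases hl : p * (1 - q) ≠ 0 ∧ (1 - p) * (1 - q) ≠ 0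
  · left; intro lam
    rw [cOf, cOf, h10 hl.1, h00 hl.2, mul_inv_rev, mul_assoc, mul_inv_cancel_left]
  by_cases hr : (1 - p) * q ≠ 0 ∧ p * q ≠ 0
  · right; intro lam
    rw [cOf, cOf, h01 hr.1, h11 hr.2, mul_inv_rev, mul_assoc, mul_inv_cancel_left, mul_inv_rev,
      inv_inv]
  exfalso
  rw [not_and_or, not_not, not_not] at hl hr
  rcases hl with hl | hl <;> rcases hr with hr | hr
  · refine hr0 ?_
    have : p + q - 2 * (p * q) = p * (1 - q) + (1 - p) * q := by noncomm_ring
    rw [this, hl, hr, add_zero]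
  · exact hp0 (by simpa [hr, mul_sub] using hl)
  · refine hp1 (sub_eq_zero.mp ?_).symm
    simpa [mul_sub, hr] using hl
  · refine hr1 (sub_eq_zero.mp ?_).symm
    have : 1 - (p + q - 2 * (p * q)) = (1 - p) * (1 - q) + p * q := by noncomm_ring
    rw [this, hl, hr, add_zero]

end

end CoeffMaps

variable {A B : Type*}
  [NormedRing A] [StarRing A] [CStarRing A] [CompleteSpace A]
  [NormedAlgebra ℂ A] [StarModule ℂ A]
  [NormedRing B] [StarRing B] [CStarRing B] [CompleteSpace B]
  [NormedAlgebra ℂ B] [StarModule ℂ B]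


theorem statement14 [IsSimpleRing A] [IsSimpleRing B]
    (hA : OddlyDecomposable A) (φ : Aˣ ≃* Bˣ)
    (e : A) (he : IsIdempotentElem e) (he0 : e ≠ 0) (he1 : e ≠ 1)
    (f : A) (hf : IsIdempotentElem f) (hf0 : f ≠ 0) (hf1 : f ≠ 1) :
    cEquiv (⇑φ) e f ∨ cAntiEquiv (⇑φ) e f := by
  obtain ⟨n, -, hn, g, hg, hortho, hsum, hsim⟩ := hA e f he he0 he1 hf hf0 hf1
  let i₀ : Fin n := ⟨0, by omega⟩
  let i₁ : Fin n := ⟨1, by omega⟩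
  have hne : i₁ ≠ i₀ := by simp [i₀, i₁]
  obtain ⟨hg₀, hg0, hg1⟩ := hg i₀
  have hgg : g i₀ * g i₀ = g i₀ := hg₀
  have hgf : g i₀ * f = g i₀ := by
    rw [← hsum, Finset.mul_sum, Finset.sum_eq_single i₀ (fun j _ hj => hortho _ _ hj.symm)
      (by simp), hgg]
  have hfg : ∀ i, f * g i = g i := fun i => by
    rw [← hsum, Finset.sum_mul, Finset.sum_eq_single i (fun j _ hj => hortho _ _ hj) (by simp)]
    exact (hg i).1
  have hgf' : g i₀ ≠ f := fun h => (hg i₁).2.1 (by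
    rw [← hfg i₁, ← h, hortho _ _ hne.symm])
  obtain ⟨g', u, hg'₀, hg'0, -, hg', h₁, h₂, hg'e⟩ := hsim i₀
  obtain ⟨a, b, hab⟩ := exists_isCoeffMaps φ hg₀ hg0 hg1
  obtain ⟨ae, be, hae⟩ := exists_isCoeffMaps φ he he0 he1
  obtain ⟨af, bf, haf⟩ := exists_isCoeffMaps φ hf hf0 hf1
  have hab' : IsCoeffMaps φ g' a b := by
    subst hg'
    exact hab.conj hg₀ u hg'₀
  have H : (∀ lam, cOf ae be lam = cOf af bf lam) ∨ ∀ lam, cOf af bf lam = (cOf ae be lam)⁻¹ := by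
    rcases cOf_eq_or_eq_inv_of_mul_eq hg₀ hf hg0 hgf' hf1 hgf (hfg i₀) hab haf with H₁ | H₁ <;>
      rcases cOf_eq_or_eq_inv_of_mul_eq hg'₀ he hg'0 hg'e he1 h₁ h₂ hab' hae with H₂ | H₂ <;>
      simp [H₁, H₂]
  exact H.imp (fun H => ⟨ae, be, af, bf, hae, haf, H⟩) (fun H => ⟨ae, be, af, bf, hae, haf, H⟩)

end
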